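/- Let E_d : y² = x³ − dx over K = ℚ(i) with d fourth-power-free, and let 𝔭 = (π) be a degree-one prime of ℤ[i] not dividing 2d, where p = π·π̄ with π primary and p ≡ 1 (mod 4). Then the number of points of the reduction of E_d over the residue field 𝔽_p equals p + 1 − conj((d/π)₄)·π − (d/π)₄·π̄ (viewing this expression as a rational integer). -/

import Mathlib

open Zsqrtd

local notation "ℤ[i]" => GaussianInt

/-- The imaginary unit `i` in `ℤ[i]`. -/
def gi : ℤ[i] := Zsqrtd.sqrtd

/-- `α` is primary if `α ≡ 1 (mod 2(1+i))`. -/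
def IsPrimary (α : ℤ[i]) : Prop := 2 * (1 + gi) ∣ α - 1
open scoped Classical in
/-- The quartic residue symbol `(α/π)₄`: the unique power of `i` congruent to
`α ^ ((Nπ - 1)/4)` modulo `π`, where `Nπ` is the cardinality of `ℤ[i]/(π)`. -/
noncomputable def quartic (α π : ℤ[i]) : ℤ[i] :=
  if h : ∃ k : Fin 4,
      π ∣ α ^ ((Nat.card (ℤ[i] ⧸ Ideal.span {π}) - 1) / 4) - gi ^ (k : ℕ)
  then gi ^ ((h.choose : Fin 4) : ℕ) else 0

set_option linter.unusedSectionVars false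

section aux

variable {F : Type*} [Field F] [Fintype F] [DecidableEq F]

def IsT (t : ℤ[i]) : Prop := t = 0 ∨ t = 1 ∨ t = gi ∨ t = -1 ∨ t = -gi

lemma gi_sq : gi * gi = -1 := by
  ext <;> simp [gi]

lemma IsT.mul {a b : ℤ[i]} (ha : IsT a) (hb : IsT b) : IsT (a * b) := by
  have := gi_sq
  unfold IsT at *
  rcases ha with rfl | rfl | rfl | rfl | rfl <;> rcases hb with rfl | rfl | rfl | rfl | rfl <;>
    simp [this]

lemma IsT.star_mul {a : ℤ[i]} (ha : IsT a) (h0 : a ≠ 0) : star a * a = 1 := by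
  rcases ha with rfl | rfl | rfl | rfl | rfl
  · exact absurd rfl h0
  all_goals (ext <;> simp [gi])

lemma two_ne (hq : Fintype.card F % 4 = 1) : (2 : F) ≠ 0 := by
  intro h
  have h1 : ringChar F = 2 := by
    have : ringChar F ∣ 2 := by
      apply ringChar.dvd
      exact_mod_cast h
    rcases (Nat.dvd_prime Nat.prime_two).1 this with h | h
    · exact absurd h (CharP.ringChar_ne_one)
    · exact h
  have := FiniteField.even_card_of_char_two h1
  omega

lemma phi_gi (φ : ℤ[i] →+* F) : φ gi * φ gi = -1 := by
  rw [← map_mul, gi_sq]; simp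

lemma IsT.inj (hq : Fintype.card F % 4 = 1) (φ : ℤ[i] →+* F) {a b : ℤ[i]} (ha : IsT a)
    (hb : IsT b) (h : φ a = φ b) : a = b := by
  have h2 := two_ne hq
  have h3 := phi_gi φ
  unfold IsT at *
  rcases ha with rfl | rfl | rfl | rfl | rfl <;> rcases hb with rfl | rfl | rfl | rfl | rfl <;>
    simp only [map_zero, map_one, map_neg] at h <;> first | rfl | (exfalso; grind)

lemma exists_T (hq : Fintype.card F % 4 = 1) (φ : ℤ[i] →+* F) (x : F) :
    ∃ t, IsT t ∧ φ t = x ^ ((Fintype.card F - 1) / 4) := by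
  have h3 := phi_gi φ
  have hc : 1 < Fintype.card F := Fintype.one_lt_card
  by_cases hx : x = 0
  · refine ⟨0, Or.inl rfl, ?_⟩
    rw [hx, zero_pow (by omega), map_zero]
  · have := FiniteField.pow_card_sub_one_eq_one x hx
    have e : Fintype.card F - 1 = (Fintype.card F - 1) / 4 * 4 := by omega
    rw [e, pow_mul] at this
    set w := x ^ ((Fintype.card F - 1) / 4)
    have hw : (w - 1) * (w + 1) * (w - φ gi) * (w + φ gi) = 0 := by
      linear_combination this - (w^2-1)*h3
    simp only [mul_eq_zero] at hw
    rcases hw with ((h | h) | h) | h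
    · exact ⟨1, by simp [IsT], by rw [map_one]; linear_combination -h⟩
    · exact ⟨-1, by simp [IsT], by rw [map_neg, map_one]; linear_combination -h⟩
    · exact ⟨gi, by simp [IsT], by linear_combination -h⟩
    · exact ⟨-gi, by simp [IsT], by rw [map_neg]; linear_combination -h⟩

lemma exists_char (hq : Fintype.card F % 4 = 1) (φ : ℤ[i] →+* F) :
    ∃ ψ : MulChar F ℤ[i], ∀ x, IsT (ψ x) ∧ φ (ψ x) = x ^ ((Fintype.card F - 1) / 4) := by
  choose f hf1 hf2 using exists_T hq φ
  have hc : 1 < Fintype.card F := Fintype.one_lt_card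
  refine ⟨⟨⟨⟨f, ?_⟩, ?_⟩, ?_⟩, fun x => ⟨hf1 x, hf2 x⟩⟩
  · apply IsT.inj hq φ (hf1 _) (by simp [IsT])
    rw [hf2]; simp
  · intro x y
    apply IsT.inj hq φ (hf1 _) ((hf1 _).mul (hf1 _))
    rw [map_mul, hf2, hf2, hf2, mul_pow]
  · intro a ha
    have : a = 0 := by simpa using ha
    apply IsT.inj hq φ (hf1 _) (by simp [IsT])
    rw [hf2, this, map_zero, zero_pow (by omega)]

lemma sum_poly (P : Polynomial F) (h : P.natDegree < Fintype.card F - 1) :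
    ∑ x : F, P.eval x = 0 := by
  simp only [Polynomial.eval_eq_sum_range]
  rw [Finset.sum_comm]
  apply Finset.sum_eq_zero
  intro i hi
  rw [← Finset.mul_sum, FiniteField.sum_pow_lt_card_sub_one, mul_zero]
  rw [Finset.mem_range] at hi
  omega

lemma sum_sq (hF : ringChar F ≠ 2) (f : F → ℤ[i]) :
    ∑ x : F, f (x ^ 2) = ∑ u : F, ((quadraticChar F u : ℤ) + 1 : ℤ[i]) * f u := by
  rw [← Finset.sum_fiberwise (s := Finset.univ) (g := fun x : F => x ^ 2)]
  apply Finset.sum_congr rfl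
  intro u _
  have h := quadraticChar_card_sqrts hF u
  have h' : (((Finset.univ.filter (fun x : F => x ^ 2 = u)).card : ℤ) : ℤ[i])
      = (quadraticChar F u : ℤ) + 1 := by
    have h'' : ((Finset.univ.filter (fun x : F => x ^ 2 = u)).card : ℤ)
        = quadraticChar F u + 1 := by
      rw [← h]
      congr 2
      ext; simp
    rw [h'']; push_cast; rfl
  rw [← h', Finset.sum_congr rfl (g := fun _ => f u)]
  · simp
  · intro x hx
    simp at hx
    rw [hx]

lemma rho_eq (hq : Fintype.card F % 4 = 1) (hF : ringChar F ≠ 2) (φ : ℤ[i] →+* F)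
    (ψ : MulChar F ℤ[i])
    (hψ : ∀ x, IsT (ψ x) ∧ φ (ψ x) = x ^ ((Fintype.card F - 1) / 4)) (x : F) :
    ((quadraticChar F x : ℤ) : ℤ[i]) = ψ x * ψ x := by
  apply IsT.inj hq φ _ ((hψ x).1.mul (hψ x).1)
  · rw [map_mul, (hψ x).2, map_intCast, quadraticChar_eq_pow_of_char_ne_two' hF, ← pow_add]
    congr 1; omega
  · by_cases hx : x = 0
    · simp [hx, IsT]
    · rcases quadraticChar_dichotomy hx with h | h <;> simp [h, IsT]

/-- the character sum -/
lemma charsum (hq : Fintype.card F % 4 = 1) (hF : ringChar F ≠ 2) (φ : ℤ[i] →+* F)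
    (ψ : MulChar F ℤ[i])
    (hψ : ∀ x, IsT (ψ x) ∧ φ (ψ x) = x ^ ((Fintype.card F - 1) / 4)) (d : F) (hd : d ≠ 0) :
    ((∑ x : F, quadraticChar F (x ^ 3 - d * x) : ℤ) : ℤ[i]) =
      star (ψ d) * jacobiSum ψ (ψ * ψ) + ψ d * star (jacobiSum ψ (ψ * ψ)) := by
  have hρ := rho_eq hq hF φ ψ hψ
  have hm1 : ψ (-1) * ψ (-1) = 1 := by rw [← map_mul]; simp
  have hst : ∀ x, ψ x * (ψ x * ψ x) = star (ψ x) := by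
    intro x
    rcases (hψ x).1 with h | h | h | h | h <;> rw [h] <;> ext <;> simp [gi]
  have hsq : ∀ x, star (ψ x) * star (ψ x) = ψ x * ψ x := by
    intro x
    rcases (hψ x).1 with h | h | h | h | h <;> rw [h] <;> ext <;> simp [gi]
  have hd1 : star (ψ d) * ψ d = 1 := (hψ d).1.star_mul (by
    have : IsUnit (ψ d) := (IsUnit.mk0 d hd).map ψ
    exact this.ne_zero)
  have h1 : ((∑ x : F, quadraticChar F (x ^ 3 - d * x) : ℤ) : ℤ[i])
      = ∑ x : F, (fun u => ψ u * (ψ (u - d) * ψ (u - d))) (x ^ 2) := by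
    rw [Int.cast_sum]
    apply Finset.sum_congr rfl
    intro x _
    rw [show x ^ 3 - d * x = x * (x ^ 2 - d) by ring, map_mul, Int.cast_mul, hρ, hρ]
    simp [sq]
  rw [h1, sum_sq hF (fun u => ψ u * (ψ (u - d) * ψ (u - d))), ← Equiv.sum_comp (Equiv.mulLeft₀ d hd)]
  unfold jacobiSum
  rw [star_sum, Finset.mul_sum, Finset.mul_sum, ← Finset.sum_add_distrib]
  apply Finset.sum_congr rfl
  intro v _
  rw [hρ]
  simp only [Equiv.mulLeft₀_apply, MulChar.mul_apply, star_mul']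
  rw [show d * v - d = (-1) * (d * (1 - v)) by ring]
  simp only [map_mul]
  have a1 := hst v
  have a2 := hst d
  have a3 := hsq (1 - v)
  rw [a3, ← a1, ← a2]
  rw [← a2] at hd1
  generalize ψ d = D at *
  generalize ψ v = V at *
  generalize ψ (1 - v) = W at *
  generalize ψ (-1) = M at *
  linear_combination (D * D * D * V * V * V * D * D * W * W + D*V*D*D*W*W) * hm1 + D * V ^3 * W^2 * hd1

lemma gi_dvd_aux {t : ℤ[i]} (h : IsT t) (h0 : t ≠ 0) : (1 + gi) ∣ t - 1 := by
  rcases h with rfl | rfl | rfl | rfl | rfl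
  · exact absurd rfl h0
  · simp
  · exact ⟨gi, by ext <;> simp [gi]⟩
  · exact ⟨-1 + gi, by ext <;> simp [gi]⟩
  · exact ⟨-1, by ext <;> simp [gi]⟩

lemma jac_primary (hq : Fintype.card F % 4 = 1) (hF : ringChar F ≠ 2) (φ : ℤ[i] →+* F)
    (ψ : MulChar F ℤ[i])
    (hψ : ∀ x, IsT (ψ x) ∧ φ (ψ x) = x ^ ((Fintype.card F - 1) / 4))
    (h1 : ψ ≠ 1) (h2 : ψ * ψ ≠ 1) :
    2 * (1 + gi) ∣ jacobiSum ψ (ψ * ψ) + 1 := by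
  have hρ := rho_eq hq hF φ ψ hψ
  have hu : ∀ x, x ≠ 0 → ψ x ≠ 0 := fun x hx => ((IsUnit.mk0 x hx).map ψ).ne_zero
  have key : 2 * (1 + gi) ∣ ∑ x : F, (ψ x - 1) * ((ψ * ψ) (1 - x) - 1) := by
    apply Finset.dvd_sum
    intro x _
    by_cases hx : x = 0
    · simp [hx]
    by_cases hx1 : 1 - x = 0
    · have : x = 1 := by linear_combination -hx1
      simp [this]
    rw [mul_comm 2]
    apply mul_dvd_mul (gi_dvd_aux (hψ x).1 (hu x hx))
    rw [MulChar.mul_apply, ← hρ]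
    rcases quadraticChar_dichotomy hx1 with h | h <;> rw [h] 
    · simp
    · exact ⟨-1, by norm_num⟩
  have e : ∑ x : F, (ψ x - 1) * ((ψ * ψ) (1 - x) - 1) 
      = jacobiSum ψ (ψ * ψ) + (Fintype.card F : ℤ[i]) := by
    have s1 := MulChar.sum_eq_zero_of_ne_one h1
    have s2 : ∑ x : F, (ψ * ψ) (1 - x) = 0 := by
      rw [← MulChar.sum_eq_zero_of_ne_one h2]
      exact (Equiv.subLeft (1 : F)).sum_comp (fun x => (ψ * ψ) x)
    calc _ = ∑ x : F, (ψ x * (ψ * ψ) (1 - x) - ψ x - (ψ * ψ) (1 - x) + 1) := by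
            apply Finset.sum_congr rfl; intro x _; ring
      _ = _ := by
        rw [Finset.sum_add_distrib, Finset.sum_sub_distrib, Finset.sum_sub_distrib, s1, s2]
        simp [jacobiSum]
  rw [e] at key
  have h4 : 2 * (1 + gi) ∣ (Fintype.card F : ℤ[i]) - 1 := by
    obtain ⟨k, hk⟩ : ∃ k, Fintype.card F = 4 * k + 1 := ⟨Fintype.card F / 4, by omega⟩
    rw [hk]
    have : (4 : ℤ[i]) = 2 * (1 + gi) * (1 - gi) := by ext <;> simp [gi] 
    refine ⟨(1 - gi) * k, ?_⟩
    push_cast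
    rw [this]; ring
  have := dvd_sub key h4
  convert this using 1; ring

lemma jac_phi (hq : Fintype.card F % 4 = 1) (φ : ℤ[i] →+* F)
    (ψ : MulChar F ℤ[i])
    (hψ : ∀ x, IsT (ψ x) ∧ φ (ψ x) = x ^ ((Fintype.card F - 1) / 4)) :
    φ (jacobiSum ψ (ψ * ψ)) = 0 := by
  have hc : 1 < Fintype.card F := Fintype.one_lt_card
  rw [← sum_poly ((Polynomial.X : Polynomial F) ^ ((Fintype.card F - 1) / 4) *
    ((1 - Polynomial.X) ^ ((Fintype.card F - 1) / 4) * (1 - Polynomial.X) ^ ((Fintype.card F - 1) / 4)))]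
  · unfold jacobiSum
    rw [map_sum]
    apply Finset.sum_congr rfl
    intro x _
    simp [(hψ _).2]
  · have : (1 - Polynomial.X : Polynomial F).natDegree ≤ 1 := by compute_degree
    have h2 : ((1 - Polynomial.X : Polynomial F) ^ ((Fintype.card F - 1) / 4)).natDegree
      ≤ (Fintype.card F - 1) / 4 * 1 := Polynomial.natDegree_pow_le_of_le _ this
    have h3 := Polynomial.natDegree_mul_le_of_le h2 h2
    have h4 := Polynomial.natDegree_mul_le_of_le (Polynomial.natDegree_X_pow_le (R := F) ((Fintype.card F - 1) / 4)) h3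
    omega

lemma jac_norm (hF : ringChar F ≠ 2) (ψ : MulChar F ℤ[i])
    (hψ : ∀ x, IsT (ψ x)) (h1 : ψ ≠ 1) (h2 : ψ * ψ ≠ 1) (h3 : ψ * (ψ * ψ) ≠ 1) :
    jacobiSum ψ (ψ * ψ) * star (jacobiSum ψ (ψ * ψ)) = (Fintype.card F : ℤ[i]) := by
  have inj : Function.Injective GaussianInt.toComplex := GaussianInt.toComplex_injective
  have hmul : ∀ a b : MulChar F ℤ[i], (a * b).ringHomComp GaussianInt.toComplex =
      a.ringHomComp GaussianInt.toComplex * b.ringHomComp GaussianInt.toComplex := by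
    intro a b; ext; simp
  have hne : ∀ a : MulChar F ℤ[i], a ≠ 1 → a.ringHomComp GaussianInt.toComplex ≠ 1 :=
    fun a ha => (MulChar.ringHomComp_ne_one_iff inj).2 ha
  have hinv : ∀ a : MulChar F ℤ[i], (∀ x, IsT (a x)) → ∀ x,
      (a.ringHomComp GaussianInt.toComplex)⁻¹ x = GaussianInt.toComplex (star (a x)) := by
    intro a ha x
    by_cases hx : x = 0
    · rw [hx, MulChar.map_zero, MulChar.map_zero, star_zero, map_zero]
    have := (ha x).star_mul ((IsUnit.mk0 x hx).map a).ne_zero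
    rw [MulChar.inv_apply_eq_inv']
    apply inv_eq_of_mul_eq_one_right
    rw [MulChar.ringHomComp_apply, ← map_mul, mul_comm, this, map_one]
  have := jacobiSum_mul_jacobiSum_inv (F := F) (F' := ℂ) (χ := ψ.ringHomComp GaussianInt.toComplex)
    (φ := (ψ * ψ).ringHomComp GaussianInt.toComplex) (by
      rw [ringChar.eq_zero]
      exact (CharP.ringChar_ne_zero_of_finite F).symm) (hne _ h1) (hne _ h2)
      (by rw [← hmul]; exact hne _ h3)
  apply inj
  rw [map_mul, map_natCast, ← this, jacobiSum_ringHomComp]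
  congr 1
  unfold jacobiSum
  rw [star_sum, map_sum]
  apply Finset.sum_congr rfl
  intro x _
  rw [hinv _ hψ, hinv _ (fun x => by simpa using (hψ x).mul (hψ x)), ← map_mul, star_mul']

lemma char_ne (hq : Fintype.card F % 4 = 1) (hF : ringChar F ≠ 2) (φ : ℤ[i] →+* F)
    (ψ : MulChar F ℤ[i])
    (hψ : ∀ x, IsT (ψ x) ∧ φ (ψ x) = x ^ ((Fintype.card F - 1) / 4)) :
    ψ ≠ 1 ∧ ψ * ψ ≠ 1 ∧ ψ * (ψ * ψ) ≠ 1 := by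
  obtain ⟨x, hx⟩ := quadraticChar_exists_neg_one hF
  have hx0 : x ≠ 0 := by rintro rfl; simp at hx
  have h := rho_eq hq hF φ ψ hψ x
  rw [hx] at h
  have h1 : (1 : MulChar F ℤ[i]) x = 1 := MulChar.one_apply (IsUnit.mk0 x hx0)
  have hm : (-1 : ℤ[i]) ≠ 1 := by decide
  simp at h
  refine ⟨fun e => ?_, fun e => ?_, fun e => ?_⟩
  · rw [e, h1] at h; simp at h; exact hm h
  · have := congrArg (fun f : MulChar F ℤ[i] => f x) e
    simp [h1, ← h] at this
    exact hm this
  · have := congrArg (fun f : MulChar F ℤ[i] => f x) e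
    simp [h1, ← h] at this
    have h' : ψ x = -1 := by rw [← this]; simp
    rw [h'] at h; simp at h; exact hm h

lemma jac_eq (hq : Fintype.card F % 4 = 1) (hF : ringChar F ≠ 2) (φ : ℤ[i] →+* F)
    (ψ : MulChar F ℤ[i])
    (hψ : ∀ x, IsT (ψ x) ∧ φ (ψ x) = x ^ ((Fintype.card F - 1) / 4)) (π : ℤ[i])
    (hker : ∀ a, φ a = 0 → π ∣ a) (hprim : IsPrimary π)
    (hsplit : π * star π = (Fintype.card F : ℤ[i])) :
    jacobiSum ψ (ψ * ψ) = -π := by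
  obtain ⟨n1, n2, n3⟩ := char_ne hq hF φ ψ hψ
  obtain ⟨u, hu⟩ := hker _ (jac_phi hq φ ψ hψ)
  have hn := jac_norm hF ψ (fun x => (hψ x).1) n1 n2 n3
  have hp := jac_primary hq hF φ ψ hψ n1 n2
  rw [hu] at hn hp ⊢
  have hc : (Fintype.card F : ℤ[i]) ≠ 0 := by simp
  have hu1 : u * star u = 1 := by
    apply mul_left_cancel₀ hc
    rw [mul_one]
    nth_rw 2 [← hn]
    rw [← hsplit, star_mul']; ring
  have hun : u.norm = 1 := by
    have := Zsqrtd.norm_eq_mul_conj u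
    rw [hu1] at this
    exact_mod_cast this
  have hp2 : 2 * (1 + gi) ∣ u + 1 := by
    have := dvd_sub hp (Dvd.dvd.mul_right hprim u)
    convert this using 1; ring
  have : u = -1 := by
    obtain ⟨⟨a, b⟩, hk⟩ := hp2
    obtain ⟨c, d⟩ := u
    have e1 := congrArg Zsqrtd.re hk
    have e2 := congrArg Zsqrtd.im hk
    simp [gi] at e1 e2
    simp [Zsqrtd.norm_def] at hun
    have c1 : c ≤ 1 := by nlinarith
    have c2 : -1 ≤ c := by nlinarith
    have d1 : d ≤ 1 := by nlinarith
    have d2 : -1 ≤ d := by nlinarith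
    ext <;> simp <;> interval_cases c <;> interval_cases d <;> omega
  rw [this]; ring

lemma point_card (hF : ringChar F ≠ 2) (d : F) (hd : d ≠ 0) :
    (Nat.card (WeierstrassCurve.Affine.Point
        (WeierstrassCurve.toAffine (⟨0, 0, 0, -d, 0⟩ : WeierstrassCurve F))) : ℤ)
      = (Fintype.card F : ℤ) + 1 + ∑ x : F, quadraticChar F (x ^ 3 - d * x) := by
  have h2 : (2 : F) ≠ 0 := Ring.two_ne_zero hF
  set W : WeierstrassCurve F := ⟨0, 0, 0, -d, 0⟩ with hW
  have hΔ : W.Δ ≠ 0 := by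
    have : W.Δ = 2 ^ 6 * d ^ 3 := by
      simp [hW, WeierstrassCurve.Δ, WeierstrassCurve.b₂, WeierstrassCurve.b₄,
        WeierstrassCurve.b₆, WeierstrassCurve.b₈]
      ring
    rw [this]; positivity
  have hiff : ∀ x y : F, W.toAffine.Nonsingular x y ↔ y ^ 2 = x ^ 3 - d * x := by
    intro x y
    rw [← WeierstrassCurve.Affine.equation_iff_nonsingular_of_Δ_ne_zero hΔ,
      WeierstrassCurve.Affine.equation_iff]
    simp [hW, sub_eq_add_neg]
  have e : W.toAffine.Point ≃ Option (Σ x : F, {y : F // y ^ 2 = x ^ 3 - d * x}) :=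
    { toFun := fun P => match P with
        | .zero => none
        | .some x y h => some ⟨x, y, (hiff x y).1 h⟩
      invFun := fun P => match P with
        | none => .zero
        | some ⟨x, y, h⟩ => .some x y ((hiff x y).2 h)
      left_inv := by rintro (_ | _) <;> rfl
      right_inv := by rintro (_ | ⟨x, y, h⟩) <;> rfl }
  rw [Nat.card_congr e, Nat.card_eq_fintype_card, Fintype.card_option, Fintype.card_sigma]
  push_cast
  have : ∀ x : F, (Fintype.card {y : F // y ^ 2 = x ^ 3 - d * x} : ℤ) =
      quadraticChar F (x ^ 3 - d * x) + 1 := by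
    intro x
    rw [← quadraticChar_card_sqrts hF, Set.toFinset_card]
    rfl
  simp only [this, Finset.sum_add_distrib]
  simp; ring

end aux

lemma card_quot (π : ℤ[i]) (hπ : Prime π) (p : ℕ) (hp : p.Prime)
    (hsplit : π * star π = (p : ℤ[i])) : Nat.card (ℤ[i] ⧸ Ideal.span {π}) = p := by
  haveI : (Ideal.span {π}).IsMaximal := PrincipalIdealRing.isMaximal_of_irreducible hπ.irreducible
  letI : Field (ℤ[i] ⧸ Ideal.span {π}) := Ideal.Quotient.field _
  haveI := Fact.mk hp
  set φ := Ideal.Quotient.mk (Ideal.span {π}) with hφ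
  have hπ0 : φ π = 0 := by
    rw [hφ, Ideal.Quotient.eq_zero_iff_mem]; exact Ideal.mem_span_singleton_self π
  have hp0 : ((p : ℕ) : ℤ[i] ⧸ Ideal.span {π}) = 0 := by
    rw [← map_natCast φ, ← hsplit, map_mul, hπ0, zero_mul]
  haveI : CharP (ℤ[i] ⧸ Ideal.span {π}) p := (CharP.charP_iff_prime_eq_zero hp).2 hp0
  let f := ZMod.castHom (dvd_refl p) (ℤ[i] ⧸ Ideal.span {π})
  have hn : π.re * π.re + π.im * π.im = p := by
    have := congrArg Zsqrtd.re hsplit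
    simp at this
    linarith
  have hy : ((π.im : ℤ) : ℤ[i] ⧸ Ideal.span {π}) ≠ 0 := by
    intro h
    rw [CharP.intCast_eq_zero_iff _ p] at h
    have hx : (p : ℤ) ∣ π.re := by
      have : (p : ℤ) ∣ π.re * π.re := by
        have h1 : π.re * π.re = p - π.im * π.im := by linarith
        rw [h1]
        exact dvd_sub (dvd_refl _) (Dvd.dvd.mul_right h _)
      rcases (Nat.prime_iff_prime_int.1 hp).dvd_or_dvd this with h | h <;> exact h
    obtain ⟨a, ha⟩ := h
    obtain ⟨b, hb⟩ := hx
    rw [ha, hb] at hn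
    have hpz : (p : ℤ) ≠ 0 := by exact_mod_cast hp.ne_zero
    have : (p : ℤ) * (b * b + a * a) = 1 := by
      apply mul_left_cancel₀ hpz
      linarith
    have := Int.eq_one_or_neg_one_of_mul_eq_one this
    have := hp.two_le
    omega
  have hform : ∀ z : ℤ[i], φ z = (z.re : ℤ[i] ⧸ Ideal.span {π}) + z.im * φ gi := by
    intro z
    have : z = (z.re : ℤ[i]) + z.im * gi := by ext <;> simp [gi]
    conv_lhs => rw [this]
    rw [map_add, map_mul, map_intCast, map_intCast]
  have hgi : φ gi = f (-(π.re : ZMod p) / (π.im : ZMod p)) := by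
    rw [map_div₀, map_neg, map_intCast, map_intCast, eq_div_iff hy]
    have := hform π
    rw [hπ0] at this
    linear_combination -this
  have hsurj : Function.Surjective f := by
    intro w
    obtain ⟨z, rfl⟩ := Ideal.Quotient.mk_surjective w
    refine ⟨(z.re : ZMod p) + z.im * (-(π.re : ZMod p) / (π.im : ZMod p)), ?_⟩
    rw [map_add, map_mul, ← hgi, map_intCast, map_intCast]
    exact (hform z).symm
  rw [← Nat.card_congr (Equiv.ofBijective f ⟨f.injective, hsurj⟩), Nat.card_zmod]

lemma isT_pow (k : ℕ) : IsT (gi ^ k) := by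
  induction k with
  | zero => simp [IsT]
  | succ n ih => rw [pow_succ]; exact ih.mul (by simp [IsT])

lemma quartic_eq {F : Type*} [Field F] [Fintype F] [DecidableEq F]
    (hq : Fintype.card F % 4 = 1) (φ : ℤ[i] →+* F) (π d t : ℤ[i])
    (hker : ∀ a, φ a = 0 ↔ π ∣ a) (hc : Nat.card (ℤ[i] ⧸ Ideal.span {π}) = Fintype.card F)
    (ht : IsT t) (ht0 : t ≠ 0) (hd : φ t = φ d ^ ((Fintype.card F - 1) / 4)) :
    quartic d π = t := by
  have hiff : ∀ k : Fin 4, π ∣ d ^ ((Nat.card (ℤ[i] ⧸ Ideal.span {π}) - 1) / 4) - gi ^ (k : ℕ) ↔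
      t = gi ^ (k : ℕ) := by
    intro k
    rw [hc, ← hker, map_sub, map_pow, ← hd, sub_eq_zero]
    exact ⟨fun h => IsT.inj hq φ ht (isT_pow _) h, fun h => by rw [h]⟩
  have h : ∃ k : Fin 4,
      π ∣ d ^ ((Nat.card (ℤ[i] ⧸ Ideal.span {π}) - 1) / 4) - gi ^ (k : ℕ) := by
    simp only [hiff]
    rcases ht with rfl | rfl | rfl | rfl | rfl
    · exact absurd rfl ht0
    · exact ⟨0, by simp⟩
    · exact ⟨1, by simp⟩
    · exact ⟨2, by ext <;> simp [gi, sq]⟩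
    · exact ⟨3, by ext <;> simp [gi, pow_succ]⟩
  unfold quartic
  rw [dif_pos h]
  exact ((hiff _).1 h.choose_spec).symm

/-- Point count of the reduction of `E_d : y² = x³ - dx` at a degree-one prime
`π` of `ℤ[i]` not dividing `2d`, where `p = π·π̄`, `π` primary,
`p ≡ 1 (mod 4)`: it equals `p + 1 - conj((d/π)₄)·π - (d/π)₄·π̄`. -/
theorem point_count_degree_one (d π : ℤ[i])
    (hd : ∀ x : ℤ[i], x ^ 4 ∣ d → IsUnit x)
    (hπ : Prime π) (hprim : IsPrimary π)
    (p : ℕ) (hp : p.Prime) (hp1 : p % 4 = 1)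
    (hsplit : π * star π = (p : ℤ[i]))
    (hnd : ¬ π ∣ 2 * d) :
    (Nat.card (WeierstrassCurve.Affine.Point
        (WeierstrassCurve.toAffine
          ⟨0, 0, 0, -(Ideal.Quotient.mk (Ideal.span {π}) d), 0⟩)) : ℤ)
      = (p : ℤ) + 1 - (star (quartic d π) * π + quartic d π * star π).re := by
  classical
  haveI : (Ideal.span {π}).IsMaximal := PrincipalIdealRing.isMaximal_of_irreducible hπ.irreducible
  letI : Field (ℤ[i] ⧸ Ideal.span {π}) := Ideal.Quotient.field _
  have hcard := card_quot π hπ p hp hsplit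
  haveI : Finite (ℤ[i] ⧸ Ideal.span {π}) :=
    Nat.finite_of_card_ne_zero (by rw [hcard]; exact hp.ne_zero)
  letI : Fintype (ℤ[i] ⧸ Ideal.span {π}) := Fintype.ofFinite _
  have hcf : Fintype.card (ℤ[i] ⧸ Ideal.span {π}) = p := by
    rw [← Nat.card_eq_fintype_card, hcard]
  have hq : Fintype.card (ℤ[i] ⧸ Ideal.span {π}) % 4 = 1 := by rw [hcf, hp1]
  have hF : ringChar (ℤ[i] ⧸ Ideal.span {π}) ≠ 2 := by
    intro h
    have := FiniteField.even_card_of_char_two h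
    omega
  have hker : ∀ a, Ideal.Quotient.mk (Ideal.span {π}) a = 0 ↔ π ∣ a := fun a => by
    rw [Ideal.Quotient.eq_zero_iff_mem, Ideal.mem_span_singleton]
  have hd0 : Ideal.Quotient.mk (Ideal.span {π}) d ≠ 0 := by
    rw [Ne, hker]
    exact fun h => hnd (Dvd.dvd.mul_left h 2)
  obtain ⟨ψ, hψ⟩ := exists_char hq (Ideal.Quotient.mk (Ideal.span {π}))
  have hj := jac_eq hq hF _ ψ hψ π (fun a h => (hker a).1 h) hprim (by rw [hcf, hsplit])
  have hs := charsum hq hF _ ψ hψ _ hd0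
  have hqd : quartic d π = ψ (Ideal.Quotient.mk (Ideal.span {π}) d) :=
    quartic_eq hq (Ideal.Quotient.mk (Ideal.span {π})) π d _ hker (by rw [hcf, hcard]) (hψ _).1
      ((IsUnit.mk0 _ hd0).map ψ).ne_zero (hψ _).2
  have hpc := point_card hF _ hd0
  rw [hj, ← hqd] at hs
  have hre := congrArg Zsqrtd.re hs
  rw [Zsqrtd.re_intCast] at hre
  refine hpc.trans ?_
  rw [hre, hcf, star_neg, mul_neg, mul_neg, ← neg_add, Zsqrtd.re_neg]
  ring
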